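/- Let B = k[x,y,z] = k^[3] and suppose D is an irreducible locally nilpotent derivation of B with Dx = 0 and D ≠ 0. Then there exist p ∈ B and a nonzero polynomial f(x) ∈ k[x] such that ker D = k[x,p] and the plinth ideal of D equals f(x)·k[x,p]. -/

import Mathlib

open MvPolynomial

set_option synthInstance.maxHeartbeats 400000
set_option maxHeartbeats 1000000

noncomputable section

/-- `D` is a locally nilpotent derivation: every element is killed by some power of `D`. -/
def IsLND {k B : Type*} [CommRing k] [CommRing B] [Algebra k B]
    (D : Derivation k B B) : Prop :=
  ∀ b : B, ∃ n : ℕ, (⇑D)^[n] b = 0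

/-- A derivation `D` is irreducible if the only principal ideal of `B` containing the
image of `D` is `B` itself. -/
def IsIrreducibleDeriv {k B : Type*} [CommRing k] [CommRing B] [Algebra k B]
    (D : Derivation k B B) : Prop :=
  ∀ b : B, (∀ r : B, D r ∈ Ideal.span {b}) → IsUnit b

theorem der_alg {k B : Type*} [CommRing k] [CommRing B] [IsDomain B] [CharZero B] [Algebra k B]
    (D : Derivation k B B) (S : Subalgebra k B) (hS : ∀ s ∈ S, D s = 0) (b : B)
    (hb : IsAlgebraic S b) : D b = 0 := by
  let L : B →ₗ[S] B :=
    { toFun := D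
      map_add' := map_add D
      map_smul' := by
        intro m x
        have := hS m.1 m.2
        change D (m.1 * x) = m.1 * D x
        rw [Derivation.leibniz, this]
        simp }
  let D' : Derivation S B B := Derivation.mk' L (fun a b => D.leibniz a b)
  have key : ∀ n : ℕ, ∀ q : Polynomial S, q.natDegree = n → q ≠ 0 → Polynomial.aeval b q = 0 →
      D b = 0 := by
    intro n
    induction n using Nat.strong_induction_on with
    | _ n ih =>
      intro q hq hq0 hqa
      by_cases hd : Polynomial.derivative q = 0
      · exfalso
        have h0 := Polynomial.derivative_eq_zero.mp hd
        rw [Polynomial.eq_C_of_natDegree_eq_zero h0] at hqa hq0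
        simp at hqa hq0
        exact hq0 hqa
      · have h1 : D' (Polynomial.aeval b q) = Polynomial.aeval b (Polynomial.derivative q) • D' b :=
          D'.map_aeval q b
        rw [hqa, map_zero, smul_eq_mul] at h1
        rcases mul_eq_zero.mp h1.symm with h | h
        · refine ih _ ?_ _ rfl hd h
          rw [← hq]
          apply Polynomial.natDegree_derivative_lt
          intro h0
          apply hd
          rw [Polynomial.eq_C_of_natDegree_eq_zero h0]
          simp
        · exact h
  obtain ⟨q, hq0, hq⟩ := hb
  exact key _ q rfl hq0 hq

theorem der_iter_zero {k B : Type*} [CommRing k] [CommRing B] [Algebra k B]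
    (D : Derivation k B B) (n : ℕ) : (⇑D)^[n] 0 = 0 := by
  induction n with
  | zero => rfl
  | succ n ih => simp [Function.iterate_succ, ih]

theorem der_iter_add {k B : Type*} [CommRing k] [CommRing B] [Algebra k B]
    (D : Derivation k B B) (n : ℕ) (a b : B) : (⇑D)^[n] (a + b) = (⇑D)^[n] a + (⇑D)^[n] b := by
  induction n generalizing a b with
  | zero => rfl
  | succ n ih => simp [Function.iterate_succ, ih]

theorem der_iter_leibniz {k B : Type*} [CommRing k] [CommRing B] [Algebra k B]
    (D : Derivation k B B) : ∀ (N m n : ℕ) (a b : B), m + n = N → (⇑D)^[m+1] a = 0 →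
    (⇑D)^[n+1] b = 0 → (⇑D)^[m+n+1] (a*b) = 0 ∧
      (⇑D)^[m+n] (a*b) = (Nat.choose (m+n) m : B) * ((⇑D)^[m] a * (⇑D)^[n] b) := by
  intro N
  induction N with
  | zero =>
    intro m n a b h ha hb
    obtain ⟨rfl, rfl⟩ : m = 0 ∧ n = 0 := by omega
    simp at ha hb ⊢
    simp [ha, hb]
  | succ N ih =>
    intro m n a b h ha hb
    have hab : D (a * b) = a * D b + D a * b := by
      rw [Derivation.leibniz]; simp [mul_comm]
    have e1 : (⇑D)^[m+n] (a * D b) = 0 ∧ (⇑D)^[N] (a * D b) =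
        if n = 0 then 0 else (Nat.choose N m : B) * ((⇑D)^[m] a * (⇑D)^[n] b) := by
      cases n with
      | zero => 
        have : D b = 0 := by simpa using hb
        simp [this, der_iter_zero]
      | succ n =>
        have := ih m n a (D b) (by omega) ha hb
        obtain rfl : N = m + n := by omega
        exact ⟨this.1, by simpa using this.2⟩
    have e2 : (⇑D)^[m+n] (D a * b) = 0 ∧ (⇑D)^[N] (D a * b) =
        if m = 0 then 0 else (Nat.choose N (m-1) : B) * ((⇑D)^[m] a * (⇑D)^[n] b) := by
      cases m with
      | zero => 
        have : D a = 0 := by simpa using ha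
        simp [this, der_iter_zero]
      | succ m =>
        have := ih m n (D a) b (by omega) ha hb
        obtain rfl : N = m + n := by omega
        refine ⟨?_, by simpa using this.2⟩
        rw [show m + 1 + n = m + n + 1 by ring]
        exact this.1
    constructor
    · rw [Function.iterate_succ, Function.comp, hab, der_iter_add, e1.1, e2.1, add_zero]
    · rw [h, Function.iterate_succ, Function.comp, hab, der_iter_add, e1.2, e2.2]
      rcases Nat.eq_zero_or_pos m with rfl | hm
      · have : n ≠ 0 := by omega
        simp [this]
      · rcases Nat.eq_zero_or_pos n with rfl | hn
        · have h1 : m = N + 1 := by omega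
          subst h1
          simp
        · obtain ⟨m, rfl⟩ : ∃ m', m = m' + 1 := ⟨m - 1, by omega⟩
          have : n ≠ 0 := by omega
          simp [this, Nat.choose_succ_succ]
          ring

theorem exists_last {k B : Type*} [CommRing k] [CommRing B] [Algebra k B]
    (D : Derivation k B B) (hD : IsLND D) (a : B) (ha : a ≠ 0) :
    ∃ m, (⇑D)^[m] a ≠ 0 ∧ (⇑D)^[m+1] a = 0 := by
  classical
  have h := hD a
  have h1 := Nat.find_spec h
  have h0 : Nat.find h ≠ 0 := by
    intro h0
    rw [h0] at h1
    exact ha h1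
  refine ⟨Nat.find h - 1, Nat.find_min h (by omega), ?_⟩
  rwa [Nat.sub_add_cancel (by omega)]

theorem fact_closed {k B : Type*} [CommRing k] [CommRing B] [IsDomain B] [CharZero B] [Algebra k B]
    (D : Derivation k B B) (hD : IsLND D) (a b : B) (hab : a * b ≠ 0) (h : D (a * b) = 0) :
    D a = 0 := by
  obtain ⟨m, hm, hm'⟩ := exists_last D hD a (left_ne_zero_of_mul hab)
  obtain ⟨n, hn, hn'⟩ := exists_last D hD b (right_ne_zero_of_mul hab)
  have := (der_iter_leibniz D _ m n a b rfl hm' hn').2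
  have h2 : (⇑D)^[m+n] (a*b) ≠ 0 := by
    rw [this]
    refine mul_ne_zero ?_ (mul_ne_zero hm hn)
    exact_mod_cast (Nat.choose_pos (by omega)).ne'
  have h3 : m + n = 0 := by
    by_contra h3
    obtain ⟨j, hj⟩ : ∃ j, m + n = j + 1 := ⟨m + n - 1, by omega⟩
    rw [hj, Function.iterate_succ, Function.comp, h, der_iter_zero] at h2
    exact h2 rfl
  obtain rfl : m = 0 := by omega
  simpa using hm'

theorem fact_closed_dvd {k B : Type*} [CommRing k] [CommRing B] [IsDomain B] [CharZero B]
    [Algebra k B] (D : Derivation k B B) (hD : IsLND D) (a b : B) (hb : b ≠ 0) (h : D b = 0)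
    (hab : a ∣ b) : D a = 0 := by
  obtain ⟨c, rfl⟩ := hab
  exact fact_closed D hD a c hb h

theorem exists_local_slice {k B : Type*} [CommRing k] [CommRing B] [Algebra k B]
    (D : Derivation k B B) (hD : IsLND D) (hD0 : D ≠ 0) : ∃ s, D s ≠ 0 ∧ D (D s) = 0 := by
  obtain ⟨b, hb⟩ : ∃ b, D b ≠ 0 := by
    by_contra! h
    exact hD0 (Derivation.ext h)
  obtain ⟨m, hm, hm'⟩ := exists_last D hD (D b) hb
  refine ⟨(⇑D)^[m] b, ?_, ?_⟩
  · rw [← Function.iterate_succ_apply' D]; exact hm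
  · rw [← Function.iterate_succ_apply' D, ← Function.iterate_succ_apply' D]; exact hm'

theorem pair_indep {R A : Type} [CommRing R] [IsDomain R] [CommRing A] [IsDomain A] [Algebra R A]
    (u v : A) (hu : Transcendental R u) (hv : Transcendental (Algebra.adjoin R {u}) v) :
    AlgebraicIndependent R (fun o : Option Unit => o.elim v (fun _ => u)) := by
  have h1 : AlgebraicIndependent R (fun _ : Unit => u) := by
    rw [algebraicIndependent_unique_type_iff]; exact hu
  rw [h1.option_iff_transcendental]
  rw [Set.range_const]; exact hv

theorem pair_alg {R : Type} [CommRing R] [IsDomain R] 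
    (x : Option Unit → MvPolynomial (Fin 2) R) (hx : AlgebraicIndependent R x)
    (b : MvPolynomial (Fin 2) R) : IsAlgebraic (Algebra.adjoin R (Set.range x)) b := by
  have := hx.isTranscendenceBasis_of_trdeg_le_of_finite (by
    rw [MvPolynomial.trdeg_of_isDomain]; simp)
  exact this.isAlgebraic.1 b

theorem not_alg_one {R : Type} [CommRing R] [IsDomain R] (s : MvPolynomial (Fin 2) R) :
    ¬ ∀ b : MvPolynomial (Fin 2) R, IsAlgebraic (Algebra.adjoin R {s}) b := by
  intro h
  have : Algebra.IsAlgebraic (Algebra.adjoin R {s}) (MvPolynomial (Fin 2) R) := ⟨h⟩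
  have := Algebra.IsAlgebraic.trdeg_le_cardinalMk R ({s} : Set (MvPolynomial (Fin 2) R))
  rw [MvPolynomial.trdeg_of_isDomain] at this
  simp at this

theorem antider {R : Type} [CommRing R] [IsDomain R] [CharZero R]
    (D : Derivation R (MvPolynomial (Fin 2) R) (MvPolynomial (Fin 2) R))
    (s : MvPolynomial (Fin 2) R) (r : R) (hs : D s = C r) (q : Polynomial R) :
    ∃ M : ℕ, M ≠ 0 ∧ ∃ q' : Polynomial R,
      D (Polynomial.aeval s q') = C ((M : R) * r) * Polynomial.aeval s q := by
  induction q using Polynomial.induction_on' with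
  | add f g hf hg =>
    obtain ⟨M, hM, f', hf'⟩ := hf
    obtain ⟨N, hN, g', hg'⟩ := hg
    refine ⟨M * N, mul_ne_zero hM hN, Polynomial.C (N : R) * f' + Polynomial.C (M : R) * g', ?_⟩
    have e : ∀ (t : R) (b : MvPolynomial (Fin 2) R), D (C t * b) = C t * D b := by
      intro t b
      simp
    simp only [map_add, map_mul, Polynomial.aeval_C, MvPolynomial.algebraMap_eq, e, hf', hg']
    push_cast
    simp only [map_mul]
    ring
  | monomial n a =>
    refine ⟨n + 1, by omega, Polynomial.monomial (n+1) a, ?_⟩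
    rw [Polynomial.aeval_monomial, Polynomial.aeval_monomial, MvPolynomial.algebraMap_eq,
      Derivation.leibniz, MvPolynomial.derivation_C, Derivation.leibniz_pow, hs]
    simp
    ring

theorem slice_alg {R : Type} [CommRing R] [IsDomain R] [CharZero R]
    (D : Derivation R (MvPolynomial (Fin 2) R) (MvPolynomial (Fin 2) R))
    (hker : ∀ a, D a = 0 → ∃ r, a = C r)
    (s : MvPolynomial (Fin 2) R) (r : R) (hr : r ≠ 0) (hs : D s = C r) (n : ℕ) :
    ∀ b, (⇑D)^[n] b = 0 → ∃ r' : R, r' ≠ 0 ∧ ∃ q : Polynomial R, C r' * b = Polynomial.aeval s q := by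
  induction n with
  | zero =>
    intro b hb
    have : b = 0 := hb
    exact ⟨1, one_ne_zero, 0, by simp [this]⟩
  | succ n ih =>
    intro b hb
    obtain ⟨r', hr', q, hq⟩ := ih (D b) hb
    obtain ⟨M, hM, q', hq'⟩ := antider D s r hs q
    have h0 : D (C ((M : R) * r * r') * b - Polynomial.aeval s q') = 0 := by
      rw [map_sub, hq', ← hq]
      simp [mul_assoc]
    obtain ⟨t, ht⟩ := hker _ h0
    refine ⟨M * r * r', mul_ne_zero (mul_ne_zero (by exact_mod_cast hM) hr) hr',
      q' + Polynomial.C t, ?_⟩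
    rw [map_add, Polynomial.aeval_C, MvPolynomial.algebraMap_eq, ← ht]
    ring

theorem ker_nontriv {R : Type} [CommRing R] [IsDomain R] [CharZero R]
    (D : Derivation R (MvPolynomial (Fin 2) R) (MvPolynomial (Fin 2) R))
    (hD : IsLND D) (hD0 : D ≠ 0) : ∃ a, D a = 0 ∧ ∀ r, a ≠ C r := by
  by_contra! hker
  obtain ⟨s, hs0, hs⟩ := exists_local_slice D hD hD0
  obtain ⟨r, hr⟩ := hker _ hs
  have hr0 : r ≠ 0 := by
    rintro rfl
    exact hs0 (by simpa using hr)
  apply not_alg_one s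
  intro b
  obtain ⟨n, hn⟩ := hD b
  obtain ⟨r', hr', q, hq⟩ := slice_alg D hker s r hr0 hr n b hn
  let S := Algebra.adjoin R ({s} : Set (MvPolynomial (Fin 2) R))
  have hm : Polynomial.aeval s q ∈ S := Polynomial.aeval_mem_adjoin_singleton R s
  refine ⟨Polynomial.C (algebraMap R S r') * Polynomial.X - Polynomial.C ⟨_, hm⟩, ?_, ?_⟩
  · intro h
    have := congrArg (fun f => Polynomial.coeff f 1) h
    simp only [Polynomial.coeff_sub, Polynomial.coeff_C_mul, Polynomial.coeff_X_one, mul_one,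
      Polynomial.coeff_C_succ, sub_zero, Polynomial.coeff_zero] at this
    have h2 := congrArg (fun z : S => (z : MvPolynomial (Fin 2) R)) this
    have h3 : (C r' : MvPolynomial (Fin 2) R) = 0 := h2
    exact hr' (by simpa using h3)
  · rw [map_sub, map_mul, Polynomial.aeval_C, Polynomial.aeval_X, Polynomial.aeval_C]
    change C r' * b - Polynomial.aeval s q = 0
    rw [hq, sub_self]

theorem prime_dvd_ker {R : Type} [CommRing R] [IsDomain R] [CharZero R]
    (D : Derivation R (MvPolynomial (Fin 2) R) (MvPolynomial (Fin 2) R)) (hD0 : D ≠ 0)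
    (p a : MvPolynomial (Fin 2) R) (hp : Prime p) (hDp : D p = 0) (hDa : D a = 0)
    (hep : constantCoeff p = 0) (hea : constantCoeff a = 0) : p ∣ a := by
  by_cases ha0 : a = 0
  · simp [ha0]
  have hta : Transcendental R a := by
    intro h
    obtain ⟨q, hq0, hq⟩ := h.exists_nonzero_coeff_and_aeval_eq_zero (mem_nonZeroDivisors_of_ne_zero ha0)
    apply hq0
    have := congrArg constantCoeff hq
    rw [Polynomial.aeval_def, Polynomial.hom_eval₂, hea] at this
    simpa [Polynomial.eval₂_at_zero] using this
  have hpa : IsAlgebraic (Algebra.adjoin R {a}) p := by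
    by_contra htp
    have hind := pair_indep a p hta htp
    apply hD0
    refine Derivation.ext fun b => ?_
    change D b = 0
    refine der_alg D (Algebra.adjoin R (Set.range _)) ?_ b (pair_alg _ hind b)
    intro s hs
    induction hs using Algebra.adjoin_induction with
    | mem x hx =>
      obtain ⟨o, rfl⟩ := hx
      cases o with
      | none => exact hDp
      | some _ => exact hDa
    | algebraMap r => simp
    | add x y _ _ hx hy => simp [hx, hy]
    | mul x y _ _ hx hy => simp [hx, hy]
  obtain ⟨q, hq0, hq⟩ := hpa.exists_nonzero_coeff_and_aeval_eq_zero
    (mem_nonZeroDivisors_of_ne_zero hp.ne_zero)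
  have hdv : p ∣ (q.coeff 0 : MvPolynomial (Fin 2) R) := by
    have h1 := Polynomial.X_mul_divX_add q
    rw [← h1, map_add, map_mul, Polynomial.aeval_X, Polynomial.aeval_C] at hq
    refine ⟨-Polynomial.aeval p q.divX, ?_⟩
    have h2 : p * Polynomial.aeval p q.divX + (q.coeff 0 : MvPolynomial (Fin 2) R) = 0 := hq
    linear_combination h2
  obtain ⟨G, hG⟩ : ∃ G : Polynomial R, Polynomial.aeval a G = (q.coeff 0 : MvPolynomial (Fin 2) R) := by
    have h1 : ∀ z ∈ Algebra.adjoin R ({a} : Set (MvPolynomial (Fin 2) R)),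
        ∃ G : Polynomial R, Polynomial.aeval a G = z := by
      intro z hz
      rw [Algebra.adjoin_singleton_eq_range_aeval] at hz
      exact hz
    exact h1 _ (q.coeff 0).2
  have hG0 : G ≠ 0 := by
    rintro rfl
    apply hq0
    apply Subtype.ext
    rw [← hG]; simp
  obtain ⟨H, hH, hHd⟩ := Polynomial.exists_eq_pow_rootMultiplicity_mul_and_not_dvd G hG0 0
  simp only [Polynomial.C_0, sub_zero, Polynomial.X_dvd_iff] at hH hHd
  rw [← hG, hH, map_mul, map_pow, Polynomial.aeval_X] at hdv
  rcases hp.dvd_or_dvd hdv with h | h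
  · exact hp.dvd_of_dvd_pow h
  · exfalso
    apply hHd
    obtain ⟨c, hc⟩ := h
    have := congrArg constantCoeff hc
    rw [Polynomial.aeval_def, Polynomial.hom_eval₂, hea, map_mul, hep] at this
    simpa [Polynomial.eval₂_at_zero] using this

theorem ker_eq {R : Type} [CommRing R] [IsDomain R] [UniqueFactorizationMonoid R] [CharZero R]
    (D : Derivation R (MvPolynomial (Fin 2) R) (MvPolynomial (Fin 2) R))
    (hD : IsLND D) (hD0 : D ≠ 0) : ∃ p, ∀ a, D a = 0 ↔ a ∈ Algebra.adjoin R {p} := by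
  obtain ⟨a₀, ha₀, ha₀'⟩ := ker_nontriv D hD hD0
  obtain ⟨p, hp, hDp, hep⟩ : ∃ p, Prime p ∧ D p = 0 ∧ constantCoeff p = 0 := by
    have key : ∀ b : MvPolynomial (Fin 2) R, b ≠ 0 → constantCoeff b = 0 → ∃ p, Prime p ∧ p ∣ b ∧ constantCoeff p = 0 := by
      intro b
      induction b using UniqueFactorizationMonoid.induction_on_prime with
      | h₁ => simp
      | h₂ x hx =>
        intro _ h
        have := hx.map (constantCoeff (σ := Fin 2) (R := R))
        rw [h] at this
        simp at this
      | h₃ b p hb hp ih =>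
        intro _ h
        rw [map_mul] at h
        rcases mul_eq_zero.mp h with h | h
        · exact ⟨p, hp, dvd_mul_right _ _, h⟩
        · obtain ⟨p', h1, h2, h3⟩ := ih hb h
          exact ⟨p', h1, h2.mul_left _, h3⟩
    have hne : a₀ - C (constantCoeff a₀) ≠ 0 := sub_ne_zero.mpr (ha₀' _)
    obtain ⟨p, h1, h2, h3⟩ := key _ hne (by simp)
    exact ⟨p, h1, fact_closed_dvd D hD _ _ hne (by simp [ha₀]) h2, h3⟩
  refine ⟨p, fun a => ⟨?_, ?_⟩⟩
  · have hdeg : p.totalDegree ≠ 0 := by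
      intro h
      rw [MvPolynomial.totalDegree_eq_zero_iff_eq_C] at h
      rw [h] at hep
      simp only [constantCoeff_C] at hep
      rw [hep] at h
      exact hp.ne_zero (by simpa using h)
    have hC : ∀ r, C r ∈ Algebra.adjoin R {p} := fun r => Subalgebra.algebraMap_mem _ r
    have key : ∀ n : ℕ, ∀ a : MvPolynomial (Fin 2) R, a.totalDegree = n → D a = 0 → a ∈ Algebra.adjoin R {p} := by
      intro n
      induction n using Nat.strong_induction_on with
      | _ n ih =>
        intro a han ha
        obtain ⟨c, hc⟩ := prime_dvd_ker D hD0 p (a - C (constantCoeff a)) hp hDp (by simp [ha]) hep (by simp)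
        by_cases hc0 : c = 0
        · rw [hc0, mul_zero, sub_eq_zero] at hc
          rw [hc]; exact hC _
        · have h1 : a = p * c + C (constantCoeff a) := by rw [← hc]; ring
          rw [h1]
          refine add_mem (mul_mem (Algebra.self_mem_adjoin_singleton R p) ?_) (hC _)
          have hne : p * c ≠ 0 := mul_ne_zero hp.ne_zero hc0
          refine ih c.totalDegree ?_ c rfl (fact_closed_dvd D hD c (p * c) hne ?_ (dvd_mul_left _ _))
          · have h2 := MvPolynomial.totalDegree_mul_of_isDomain hp.ne_zero hc0
            have h3 : (p * c).totalDegree ≤ a.totalDegree := by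
              rw [← hc]
              refine (MvPolynomial.totalDegree_sub _ _).trans ?_
              simp
            omega
          · rw [← hc]; simp [ha]
    exact key _ a rfl
  · intro ha
    induction ha using Algebra.adjoin_induction with
    | mem x hx => rw [Set.mem_singleton_iff.mp hx]; exact hDp
    | algebraMap r => simp
    | add x y _ _ hx hy => simp [hx, hy]
    | mul x y _ _ hx hy => simp [hx, hy]

theorem const_mod_prime {F : Type} [Field F] [IsAlgClosed F] [CharZero F]
    (E : Derivation F (MvPolynomial (Fin 2) F) (MvPolynomial (Fin 2) F))
    (π s b : MvPolynomial (Fin 2) F) (hπ : Prime π) (hEπ : E π = 0) (hs : π ∣ E s)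
    (hb : ¬ π ∣ E b) : ∃ μ : F, π ∣ s - C μ := by
  let I : Ideal (MvPolynomial (Fin 2) F) := Ideal.span {π}
  have hI : I.IsPrime := (Ideal.span_singleton_prime hπ.ne_zero).mpr hπ
  let f : MvPolynomial (Fin 2) F →ₐ[F] (MvPolynomial (Fin 2) F ⧸ I) := Ideal.Quotient.mkₐ F I
  have hf : Function.Surjective f := Ideal.Quotient.mkₐ_surjective F I
  have hf0 : ∀ x, f x = 0 ↔ π ∣ x := by
    intro x
    rw [← Ideal.mem_span_singleton]
    exact Ideal.Quotient.eq_zero_iff_mem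
  have : CharZero (MvPolynomial (Fin 2) F ⧸ I) :=
    charZero_of_injective_algebraMap (algebraMap F (MvPolynomial (Fin 2) F ⧸ I)).injective
  have hd : ∀ x, f x = 0 → f (E x) = 0 := by
    intro x hx
    rw [hf0] at hx ⊢
    obtain ⟨c, rfl⟩ := hx
    rw [Derivation.leibniz, hEπ]
    simp
  let E' : Derivation F (MvPolynomial (Fin 2) F ⧸ I) (MvPolynomial (Fin 2) F ⧸ I) :=
    Derivation.liftOfSurjective hf hd
  have hE' : ∀ x, E' (f x) = f (E x) := Derivation.liftOfSurjective_apply hf hd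
  by_cases hal : IsAlgebraic F (f s)
  · obtain ⟨μ, hμ⟩ := minpoly.mem_range_of_degree_eq_one F (f s)
      (IsAlgClosed.degree_eq_one_of_irreducible F (minpoly.irreducible hal.isIntegral))
    refine ⟨μ, ?_⟩
    rw [← hf0, map_sub, ← hμ, sub_eq_zero]
    rfl
  · exfalso
    apply hb
    rw [← hf0, ← hE']
    refine der_alg E' (Algebra.adjoin F {f s}) ?_ _ ?_
    · intro t ht
      induction ht using Algebra.adjoin_induction with
      | mem x hx =>
        rw [Set.mem_singleton_iff.mp hx, hE', hf0]; exact hs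
      | algebraMap r => simp
      | add x y _ _ hx hy => simp [hx, hy]
      | mul x y _ _ hx hy => simp [hx, hy]
    · by_contra htb
      have hind := pair_indep (f s) (f b) hal htb
      have hx : (fun o : Option Unit => o.elim (f b) (fun _ => f s)) =
          f ∘ (fun o : Option Unit => o.elim b (fun _ => s)) := by
        funext o; cases o <;> rfl
      rw [hx] at hind
      have hind' := hind.of_comp f
      obtain ⟨q, hq0, hq⟩ := (pair_alg _ hind' π).exists_nonzero_coeff_and_aeval_eq_zero
        (mem_nonZeroDivisors_of_ne_zero hπ.ne_zero)
      have hdv : π ∣ (q.coeff 0 : MvPolynomial (Fin 2) F) := by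
        have h1 := Polynomial.X_mul_divX_add q
        rw [← h1, map_add, map_mul, Polynomial.aeval_X, Polynomial.aeval_C] at hq
        refine ⟨-Polynomial.aeval π q.divX, ?_⟩
        have h2 : π * Polynomial.aeval π q.divX + (q.coeff 0 : MvPolynomial (Fin 2) F) = 0 := hq
        linear_combination h2
      obtain ⟨G, hG⟩ : ∃ G : MvPolynomial (Option Unit) F,
          MvPolynomial.aeval (fun o : Option Unit => o.elim b (fun _ => s)) G =
            (q.coeff 0 : MvPolynomial (Fin 2) F) := by
        have h1 : ∀ z ∈ Algebra.adjoin F (Set.range (fun o : Option Unit => o.elim b (fun _ => s))),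
            ∃ G : MvPolynomial (Option Unit) F,
              MvPolynomial.aeval (fun o : Option Unit => o.elim b (fun _ => s)) G = z := by
          intro z hz
          rw [Algebra.adjoin_range_eq_range_aeval] at hz
          exact hz
        exact h1 _ (q.coeff 0).2
      have hG0 : G = 0 := by
        apply hind
        rw [← hf0, ← hG, MvPolynomial.comp_aeval_apply] at hdv
        rw [map_zero]
        exact hdv
      apply hq0
      apply Subtype.ext
      rw [← hG, hG0]; simp

theorem alg_closed_case {F : Type} [Field F] [IsAlgClosed F] [CharZero F]
    (D : Derivation F (MvPolynomial (Fin 2) F) (MvPolynomial (Fin 2) F))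
    (hD : IsLND D) (hD0 : D ≠ 0) : ∃ s, D s ≠ 0 ∧ D (D s) = 0 ∧ ∀ b, D s ∣ D b := by
  classical
  have hex : ∃ n : ℕ, ∃ s, D s ≠ 0 ∧ D (D s) = 0 ∧ (D s).totalDegree = n := by
    obtain ⟨s, h1, h2⟩ := exists_local_slice D hD hD0
    exact ⟨_, s, h1, h2, rfl⟩
  obtain ⟨s, hs0, hs1, hsn⟩ := Nat.find_spec hex
  have hmin : ∀ t, D t ≠ 0 → D (D t) = 0 → (D s).totalDegree ≤ (D t).totalDegree := by
    intro t h1 h2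
    rw [hsn]
    exact Nat.find_min' hex ⟨t, h1, h2, rfl⟩
  have hunit : ∀ π : MvPolynomial (Fin 2) F, Prime π → π.totalDegree ≠ 0 := by
    intro π hπ h
    rw [MvPolynomial.totalDegree_eq_zero_iff_eq_C] at h
    apply hπ.not_unit
    rw [h]
    apply IsUnit.map
    rw [isUnit_iff_ne_zero]
    intro h0
    rw [h0] at h
    exact hπ.ne_zero (by simpa using h)
  have key : ∀ n : ℕ, ∀ (E : Derivation F (MvPolynomial (Fin 2) F) (MvPolynomial (Fin 2) F))
      (g : MvPolynomial (Fin 2) F), (∀ b, D b = g * E b) → (E s).totalDegree = n →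
      ∀ b, E s ∣ E b := by
    intro n
    induction n using Nat.strong_induction_on with
    | _ n ih =>
      intro E g hg hn b
      have hg0 : g ≠ 0 := by
        rintro rfl
        exact hs0 (by rw [hg]; simp)
      have hEs0 : E s ≠ 0 := by
        intro h
        exact hs0 (by rw [hg, h]; simp)
      by_cases hu : IsUnit (E s)
      · exact hu.dvd
      obtain ⟨π, hirr, hπE⟩ := WfDvdMonoid.exists_irreducible_factor hu hEs0
      have hπ := hirr.prime
      have hDπ : D π = 0 := fact_closed_dvd D hD π (D s) hs0 hs1 (by
        rw [hg s]; exact hπE.mul_left _)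
      have hEπ : E π = 0 := by
        rw [hg] at hDπ
        exact (mul_eq_zero.mp hDπ).resolve_left hg0
      by_cases hall : ∀ b, π ∣ E b
      · choose w hw using fun i : Fin 2 => hall (X i)
        let E' : Derivation F (MvPolynomial (Fin 2) F) (MvPolynomial (Fin 2) F) :=
          MvPolynomial.mkDerivation F w
        have hE : E = π • E' := by
          apply MvPolynomial.derivation_ext
          intro i
          rw [hw, Derivation.smul_apply, MvPolynomial.mkDerivation_X, smul_eq_mul]
        have hE2 : ∀ b, E b = π * E' b := by
          intro b; rw [hE]; rfl
        have hE's : E' s ≠ 0 := by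
          intro h
          exact hEs0 (by rw [hE2, h, mul_zero])
        rw [hE2, hE2]
        apply mul_dvd_mul_left
        refine ih (E' s).totalDegree ?_ E' (g * π) ?_ rfl b
        · rw [← hn, hE2, MvPolynomial.totalDegree_mul_of_isDomain hπ.ne_zero hE's]
          have := hunit π hπ
          omega
        · intro b
          rw [hg, hE2]; ring
      · exfalso
        push Not at hall
        obtain ⟨b', hb'⟩ := hall
        obtain ⟨μ, t, ht⟩ := const_mod_prime E π s b' hπ hEπ hπE hb'
        have hst : D s = π * D t := by
          have h1 : s = C μ + π * t := by rw [← ht]; ring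
          rw [h1, map_add, Derivation.leibniz, hDπ]
          simp
        have hDt : D t ≠ 0 := by
          intro h
          exact hs0 (by rw [hst, h, mul_zero])
        have hDDt : D (D t) = 0 := by
          rw [hst, Derivation.leibniz, hDπ] at hs1
          simpa [hπ.ne_zero] using hs1
        have h1 := hmin t hDt hDDt
        rw [hst, MvPolynomial.totalDegree_mul_of_isDomain hπ.ne_zero hDt] at h1
        have := hunit π hπ
        omega
  exact ⟨s, hs0, hs1, key _ D 1 (by simp) rfl⟩

def extDer {R S : Type} [CommRing R] [CommRing S] (i : R →+* S)
    (D : Derivation R (MvPolynomial (Fin 2) R) (MvPolynomial (Fin 2) R)) :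
    Derivation S (MvPolynomial (Fin 2) S) (MvPolynomial (Fin 2) S) :=
  MvPolynomial.mkDerivation S (fun l => MvPolynomial.map i (D (X l)))

theorem extDer_map {R S : Type} [CommRing R] [CommRing S] (i : R →+* S)
    (D : Derivation R (MvPolynomial (Fin 2) R) (MvPolynomial (Fin 2) R))
    (b : MvPolynomial (Fin 2) R) :
    extDer i D (MvPolynomial.map i b) = MvPolynomial.map i (D b) := by
  induction b using MvPolynomial.induction_on with
  | C a => simp
  | add p q hp hq => simp [hp, hq]
  | mul_X p l hp =>
    have : extDer i D (X l) = MvPolynomial.map i (D (X l)) := by simp [extDer]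
    simp [hp, this]

theorem extDer_lnd {R S : Type} [CommRing R] [CommRing S] (i : R →+* S)
    (D : Derivation R (MvPolynomial (Fin 2) R) (MvPolynomial (Fin 2) R)) (hD : IsLND D) :
    IsLND (extDer i D) := by
  have hit : ∀ (n : ℕ) (w : S) (b : MvPolynomial (Fin 2) R),
      (⇑(extDer i D))^[n] (C w * MvPolynomial.map i b) = C w * MvPolynomial.map i ((⇑D)^[n] b) := by
    intro n w
    induction n with
    | zero => intro b; rfl
    | succ n ih =>
      intro b
      rw [Function.iterate_succ_apply, Function.iterate_succ_apply, ← ih]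
      simp [extDer_map]
  have hup : ∀ (b : MvPolynomial (Fin 2) S) (n m : ℕ), (⇑(extDer i D))^[n] b = 0 →
      (⇑(extDer i D))^[m + n] b = 0 := by
    intro b n m h
    rw [Function.iterate_add_apply, h, der_iter_zero]
  intro b
  induction b using MvPolynomial.induction_on' with
  | monomial u a =>
    obtain ⟨n, hn⟩ := hD (monomial u 1)
    refine ⟨n, ?_⟩
    have : (monomial u a : MvPolynomial (Fin 2) S) = C a * MvPolynomial.map i (monomial u 1) := by
      rw [map_monomial, C_mul_monomial]; simp
    rw [this, hit, hn]; simp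
  | add p q hp hq =>
    obtain ⟨n, hn⟩ := hp
    obtain ⟨m, hm⟩ := hq
    refine ⟨m + n, ?_⟩
    rw [der_iter_add, hup _ _ _ hn, Nat.add_comm, hup _ _ _ hm, add_zero]

def coefMap {K L : Type} [Field K] [Field L] [Algebra K L] (φ : L →ₗ[K] K)
    (g : MvPolynomial (Fin 2) L) : MvPolynomial (Fin 2) K :=
  ∑ m ∈ g.support, monomial m (φ (coeff m g))

theorem coeff_coefMap {K L : Type} [Field K] [Field L] [Algebra K L] (φ : L →ₗ[K] K)
    (g : MvPolynomial (Fin 2) L) (m : Fin 2 →₀ ℕ) :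
    coeff m (coefMap φ g) = φ (coeff m g) := by
  classical
  rw [coefMap, coeff_sum]
  simp only [coeff_monomial, Finset.sum_ite_eq']
  split_ifs with h
  · rfl
  · rw [notMem_support_iff.mp h, map_zero]

theorem coefMap_add {K L : Type} [Field K] [Field L] [Algebra K L] (φ : L →ₗ[K] K)
    (g h : MvPolynomial (Fin 2) L) : coefMap φ (g + h) = coefMap φ g + coefMap φ h := by
  ext m
  simp [coeff_coefMap]

theorem coefMap_mul {K L : Type} [Field K] [Field L] [Algebra K L] (φ : L →ₗ[K] K)
    (b : MvPolynomial (Fin 2) K) (g : MvPolynomial (Fin 2) L) :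
    coefMap φ (MvPolynomial.map (algebraMap K L) b * g) = b * coefMap φ g := by
  classical
  ext m
  simp only [coeff_coefMap, coeff_mul, map_sum, coeff_map, ← Algebra.smul_def, map_smul,
    smul_eq_mul]

theorem coefMap_C {K L : Type} [Field K] [Field L] [Algebra K L] (φ : L →ₗ[K] K)
    (w : L) : coefMap φ (C w) = C (φ w) := by
  classical
  ext m
  simp only [coeff_coefMap, coeff_C]
  split_ifs <;> simp

theorem coefMap_der {K L : Type} [Field K] [Field L] [Algebra K L] (φ : L →ₗ[K] K)
    (D : Derivation K (MvPolynomial (Fin 2) K) (MvPolynomial (Fin 2) K))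
    (g : MvPolynomial (Fin 2) L) :
    coefMap φ (extDer (algebraMap K L) D g) = D (coefMap φ g) := by
  induction g using MvPolynomial.induction_on' with
  | monomial u a =>
    have : (monomial u a : MvPolynomial (Fin 2) L) =
        MvPolynomial.map (algebraMap K L) (monomial u 1) * C a := by
      rw [map_monomial, mul_comm, C_mul_monomial]; simp
    rw [this, coefMap_mul, coefMap_C, Derivation.leibniz, derivation_C, smul_zero, zero_add,
      smul_eq_mul, mul_comm, extDer_map, coefMap_mul, coefMap_C, Derivation.leibniz, derivation_C,
      smul_zero, zero_add, smul_eq_mul, mul_comm]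
  | add p q hp hq => simp [coefMap_add, hp, hq]

theorem clear_denom {R : Type} [CommRing R] [IsDomain R] (g : MvPolynomial (Fin 2) (FractionRing R)) :
    ∃ r : R, r ≠ 0 ∧ ∃ b : MvPolynomial (Fin 2) R,
      MvPolynomial.map (algebraMap R (FractionRing R)) b = C (algebraMap R (FractionRing R) r) * g := by
  induction g using MvPolynomial.induction_on' with
  | monomial u a =>
    obtain ⟨x, y, hy, rfl⟩ := IsFractionRing.div_surjective R a
    have hy0 := nonZeroDivisors.ne_zero hy
    refine ⟨y, hy0, monomial u x, ?_⟩
    rw [map_monomial, C_mul_monomial]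
    congr 1
    have : algebraMap R (FractionRing R) y ≠ 0 := by simpa using hy0
    field_simp
  | add p q hp hq =>
    obtain ⟨r, hr, b, hb⟩ := hp
    obtain ⟨t, ht, c, hc⟩ := hq
    refine ⟨r * t, mul_ne_zero hr ht, C t * b + C r * c, ?_⟩
    simp only [map_add, map_mul, map_C, hb, hc]
    ring

theorem exists_prime_pos {R : Type} [CommRing R] [IsDomain R] [UniqueFactorizationMonoid R]
    (b : MvPolynomial (Fin 2) R) : b ≠ 0 → b.totalDegree ≠ 0 →
      ∃ π, Prime π ∧ π ∣ b ∧ π.totalDegree ≠ 0 := by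
  induction b using UniqueFactorizationMonoid.induction_on_prime with
  | h₁ => simp
  | h₂ x hx =>
    intro _ h
    exfalso
    apply h
    rw [MvPolynomial.isUnit_iff_eq_C_of_isReduced] at hx
    obtain ⟨r, _, rfl⟩ := hx
    simp
  | h₃ b p hb hp ih =>
    intro _ h
    rw [totalDegree_mul_of_isDomain hp.ne_zero hb] at h
    by_cases hp0 : p.totalDegree = 0
    · obtain ⟨π, h1, h2, h3⟩ := ih hb (by omega)
      exact ⟨π, h1, h2.mul_left _, h3⟩
    · exact ⟨p, hp, dvd_mul_right _ _, hp0⟩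

theorem exists_slice {R : Type} [CommRing R] [IsDomain R] [UniqueFactorizationMonoid R] [CharZero R]
    (D : Derivation R (MvPolynomial (Fin 2) R) (MvPolynomial (Fin 2) R))
    (hD : IsLND D) (hD0 : D ≠ 0) (hirr : IsIrreducibleDeriv D) :
    ∃ s r, r ≠ 0 ∧ D s = C r := by
  let K := FractionRing R
  let L := AlgebraicClosure K
  let i := algebraMap R K
  let j := algebraMap K L
  have hi : Function.Injective i := IsFractionRing.injective R K
  have hj : Function.Injective j := j.injective
  have hmi := MvPolynomial.map_injective (σ := Fin 2) i hi
  have hmj := MvPolynomial.map_injective (σ := Fin 2) j hj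
  have : CharZero K := charZero_of_injective_algebraMap hi
  have : CharZero L := charZero_of_injective_algebraMap hj
  let DK := extDer i D
  let DL := extDer j DK
  have hDK : ∀ b, DK (MvPolynomial.map i b) = MvPolynomial.map i (D b) := extDer_map i D
  have hDL : ∀ b, DL (MvPolynomial.map j b) = MvPolynomial.map j (DK b) := extDer_map j DK
  have hlnd : IsLND DL := extDer_lnd j DK (extDer_lnd i D hD)
  have hDL0 : DL ≠ 0 := by
    intro h
    apply hD0
    refine Derivation.ext fun b => ?_
    apply hmi
    apply hmj
    rw [← hDK, ← hDL, h]
    simp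
  obtain ⟨s', hs0, hs1, hdv⟩ := alg_closed_case DL hlnd hDL0
  obtain ⟨m, hm⟩ := MvPolynomial.ne_zero_iff.mp hs0
  obtain ⟨φ, hφ⟩ : ∃ φ : L →ₗ[K] K, φ (coeff m (DL s')) ≠ 0 := by
    by_contra! h
    exact hm ((Module.forall_dual_apply_eq_zero_iff K _).mp h)
  obtain ⟨r, hr, s, hs⟩ := clear_denom (coefMap φ s')
  have hc : MvPolynomial.map i (D s) = C (i r) * coefMap φ (DL s') := by
    rw [← hDK]
    change DK (MvPolynomial.map (algebraMap R (FractionRing R)) s) = _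
    rw [hs, coefMap_der, Derivation.leibniz, derivation_C, smul_zero, add_zero, smul_eq_mul]
  have hir : i r ≠ 0 := (map_ne_zero_iff i hi).mpr hr
  have hc0 : D s ≠ 0 := by
    intro h
    rw [h, map_zero] at hc
    have h1 := congrArg (coeff m) hc
    rw [coeff_C_mul, coeff_coefMap, coeff_zero] at h1
    exact mul_ne_zero hir hφ h1.symm
  obtain ⟨e, he⟩ := hdv (MvPolynomial.map j (MvPolynomial.map i s))
  rw [hDL, hDK] at he
  have he0 : e ≠ 0 := by
    rintro rfl
    rw [mul_zero] at he
    exact hc0 (hmi (hmj (by simpa using he)))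
  have hdeg : (MvPolynomial.map j (MvPolynomial.map i (D s))).totalDegree ≤ (DL s').totalDegree := by
    apply totalDegree_le_of_support_subset
    intro n hn
    rw [mem_support_iff] at hn ⊢
    intro h0
    apply hn
    rw [hc, coeff_map, coeff_C_mul, coeff_coefMap, h0]
    simp
  have hedeg : e.totalDegree = 0 := by
    rw [he, totalDegree_mul_of_isDomain hs0 he0] at hdeg
    omega
  have heu : IsUnit e := by
    rw [totalDegree_eq_zero_iff_eq_C] at hedeg
    rw [hedeg]
    apply IsUnit.map
    rw [isUnit_iff_ne_zero]
    intro h0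
    rw [h0] at hedeg
    exact he0 (by simpa using hedeg)
  have hdv2 : ∀ b, MvPolynomial.map j (MvPolynomial.map i (D s)) ∣ DL b := by
    intro b
    rw [he]
    exact (heu.mul_right_dvd).mpr (hdv b)
  obtain ⟨ψ, hψ⟩ := LinearMap.exists_leftInverse_of_injective (Algebra.linearMap K L)
    (LinearMap.ker_eq_bot.mpr hj)
  have hψ1 : ψ 1 = 1 := by
    have := LinearMap.congr_fun hψ 1
    simpa using this
  have hret : ∀ b, coefMap ψ (MvPolynomial.map j b) = b := by
    intro b
    have := coefMap_mul ψ b (C 1)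
    rw [coefMap_C, hψ1] at this
    simpa using this
  have hdv3 : ∀ b, ∃ t : R, t ≠ 0 ∧ D s ∣ C t * D b := by
    intro b
    obtain ⟨w, hw⟩ := hdv2 (MvPolynomial.map j (MvPolynomial.map i b))
    rw [hDL, hDK] at hw
    have h1 := congrArg (coefMap ψ) hw
    rw [hret] at h1
    have h2 : coefMap ψ (MvPolynomial.map j (MvPolynomial.map i (D s)) * w) =
      MvPolynomial.map i (D s) * coefMap ψ w := coefMap_mul ψ _ _
    rw [h2] at h1
    obtain ⟨t, ht, v, hv⟩ := clear_denom (coefMap ψ w)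
    refine ⟨t, ht, v, ?_⟩
    apply hmi
    rw [map_mul, map_mul, map_C, h1]
    have hv' : MvPolynomial.map i v = C (i t) * coefMap ψ w := hv
    rw [hv']
    ring
  by_cases hd : (D s).totalDegree = 0
  · rw [totalDegree_eq_zero_iff_eq_C] at hd
    refine ⟨s, _, ?_, hd⟩
    intro h0
    rw [h0] at hd
    exact hc0 (by simpa using hd)
  · exfalso
    obtain ⟨π, hπ, hπd, hπ0⟩ := exists_prime_pos (D s) hc0 hd
    apply hπ.not_unit
    apply hirr
    intro b
    rw [Ideal.mem_span_singleton]
    obtain ⟨t, ht, htd⟩ := hdv3 b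
    refine (hπ.dvd_or_dvd (hπd.trans htd)).resolve_left ?_
    rintro ⟨w, hw⟩
    have hCt : (C t : MvPolynomial (Fin 2) R) ≠ 0 := by simpa using ht
    have hw0 : w ≠ 0 := by
      rintro rfl
      exact hCt (by simpa using hw)
    have := congrArg totalDegree hw
    rw [totalDegree_mul_of_isDomain hπ.ne_zero hw0, totalDegree_C] at this
    omega

theorem mod_prime_step {R : Type} [CommRing R] [IsDomain R] [IsPrincipalIdealRing R]
    (p s : MvPolynomial (Fin 2) R) (π : R) (hπ : Prime π) (U W : Polynomial R)
    (h : C π ∣ Polynomial.aeval p U * s + Polynomial.aeval p W)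
    (hU : ¬ C π ∣ Polynomial.aeval p U) : ∃ V : Polynomial R, C π ∣ s - Polynomial.aeval p V := by
  let I : Ideal R := Ideal.span {π}
  have hmax : I.IsMaximal := PrincipalIdealRing.isMaximal_of_irreducible hπ.irreducible
  letI : Field (R ⧸ I) := Ideal.Quotient.field I
  let f : R →+* R ⧸ I := Ideal.Quotient.mk I
  have hker : ∀ b : MvPolynomial (Fin 2) R, MvPolynomial.map f b = 0 ↔ C π ∣ b := by
    intro b
    rw [C_dvd_iff_dvd_coeff, MvPolynomial.ext_iff]
    refine forall_congr' fun m => ?_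
    rw [coeff_map, coeff_zero, ← Ideal.mem_span_singleton]
    exact Ideal.Quotient.eq_zero_iff_mem
  have hmap : ∀ q : Polynomial R, MvPolynomial.map f (Polynomial.aeval p q) =
      Polynomial.aeval (MvPolynomial.map f p) (q.map f) := by
    intro q
    rw [Polynomial.aeval_def, Polynomial.aeval_def, Polynomial.hom_eval₂, Polynomial.eval₂_map]
    congr 1
    ext r
    simp
  rw [← hker, map_add, map_mul, hmap, hmap] at h
  rw [← hker, hmap] at hU
  set P := MvPolynomial.map f p
  set S := MvPolynomial.map f s
  classical
  obtain ⟨U1, hU1⟩ := EuclideanDomain.gcd_dvd_left (U.map f) (W.map f)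
  obtain ⟨W1, hW1⟩ := EuclideanDomain.gcd_dvd_right (U.map f) (W.map f)
  set d := EuclideanDomain.gcd (U.map f) (W.map f) with hd
  have hd0 : Polynomial.aeval P d ≠ 0 := by
    intro h0
    apply hU
    rw [hU1, map_mul, h0, zero_mul]
  have hd0' : d ≠ 0 := by
    intro h0
    rw [h0, map_zero] at hd0
    exact hd0 rfl
  have h1 : Polynomial.aeval P U1 * S + Polynomial.aeval P W1 = 0 := by
    rw [hU1, hW1, map_mul, map_mul, mul_assoc, ← mul_add] at h
    exact (mul_eq_zero.mp h).resolve_left hd0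
  obtain ⟨α, β, hab⟩ : ∃ α β, U1 * α + W1 * β = 1 := by
    refine ⟨EuclideanDomain.gcdA (U.map f) (W.map f), EuclideanDomain.gcdB (U.map f) (W.map f), ?_⟩
    apply mul_left_cancel₀ hd0'
    have := EuclideanDomain.gcd_eq_gcd_ab (U.map f) (W.map f)
    rw [← hd] at this
    rw [mul_add, ← mul_assoc, ← mul_assoc, ← hU1, ← hW1, mul_one]
    exact this.symm
  have h2 : Polynomial.aeval P U1 * (Polynomial.aeval P α - S * Polynomial.aeval P β) = 1 := by
    have := congrArg (Polynomial.aeval P) hab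
    simp only [map_add, map_mul, map_one] at this
    linear_combination this - Polynomial.aeval P β * h1
  have h3 : IsUnit (Polynomial.aeval P U1) := IsUnit.of_mul_eq_one _ h2
  rw [MvPolynomial.isUnit_iff_eq_C_of_isReduced] at h3
  obtain ⟨l, hl, hl'⟩ := h3
  have hl0 : l ≠ 0 := hl.ne_zero
  obtain ⟨V, hV⟩ := Polynomial.map_surjective f Ideal.Quotient.mk_surjective
    (Polynomial.C (-l⁻¹) * W1)
  refine ⟨V, ?_⟩
  rw [← hker, map_sub, hmap, hV, map_mul, Polynomial.aeval_C, MvPolynomial.algebraMap_eq]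
  rw [hl'] at h1
  have h4 : (C l⁻¹ : MvPolynomial (Fin 2) (R ⧸ I)) * C l = 1 := by
    rw [← C_mul, inv_mul_cancel₀ hl0, C_1]
  rw [C_neg]
  change S - _ = 0
  linear_combination C l⁻¹ * h1 - S * h4

theorem main_R {R : Type} [CommRing R] [IsDomain R] [IsPrincipalIdealRing R] [CharZero R]
    (D : Derivation R (MvPolynomial (Fin 2) R) (MvPolynomial (Fin 2) R))
    (hD : IsLND D) (hD0 : D ≠ 0) (hirr : IsIrreducibleDeriv D) :
    ∃ p f, f ≠ 0 ∧ (∀ a, D a = 0 ↔ a ∈ Algebra.adjoin R {p}) ∧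
      ∀ a, (D a = 0 ∧ ∃ b, D b = a) ↔ ∃ r ∈ Algebra.adjoin R {p}, a = C f * r := by
  obtain ⟨p, hp⟩ := ker_eq D hD hD0
  obtain ⟨s₀, r₀, hr₀, hs₀⟩ := exists_slice D hD hD0 hirr
  let J : Ideal R :=
    { carrier := {r | ∃ s, D s = C r}
      add_mem' := by
        rintro a b ⟨s, hs⟩ ⟨t, ht⟩
        exact ⟨s + t, by simp [hs, ht]⟩
      zero_mem' := ⟨0, by simp⟩
      smul_mem' := by
        rintro c a ⟨s, hs⟩
        exact ⟨C c * s, by simp [hs]⟩ }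
  obtain ⟨f, hf⟩ := (IsPrincipalIdealRing.principal J).principal
  have hJ : ∀ r, (∃ s, D s = C r) ↔ f ∣ r := by
    intro r
    rw [← Ideal.mem_span_singleton]
    change r ∈ J ↔ _
    rw [hf]
  have hf0 : f ≠ 0 := by
    rintro rfl
    exact hr₀ (zero_dvd_iff.mp ((hJ r₀).mp ⟨s₀, hs₀⟩))
  obtain ⟨s, hs⟩ := (hJ f).mpr dvd_rfl
  have hpoly : ∀ a, D a = 0 → ∃ q : Polynomial R, a = Polynomial.aeval p q := by
    intro a ha
    rw [hp, Algebra.adjoin_singleton_eq_range_aeval] at ha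
    obtain ⟨q, hq⟩ := ha
    exact ⟨q, hq.symm⟩
  have hpoly' : ∀ q : Polynomial R, D (Polynomial.aeval p q) = 0 := by
    intro q
    rw [hp]
    exact Polynomial.aeval_mem_adjoin_singleton R p
  have hCD : ∀ (r : R) b, D (C r * b) = C r * D b := by
    intro r b; simp
  have key : ∀ r : R, r ≠ 0 → ∀ b u c, D u = 0 → D c = 0 → C r * b = u * s + c → C r ∣ u := by
    intro r
    induction r using UniqueFactorizationMonoid.induction_on_prime with
    | h₁ => intro h; exact absurd rfl h
    | h₂ x hx => intro _ b u c _ _ _; exact (hx.map C).dvd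
    | h₃ r π hr hπ ih =>
      intro _ b u c hu hc hb
      have hCπ : (C π : MvPolynomial (Fin 2) R) ≠ 0 := by simpa using hπ.ne_zero
      have h1 : C π ∣ u := by
        by_contra hnd
        obtain ⟨U, rfl⟩ := hpoly u hu
        obtain ⟨W, rfl⟩ := hpoly c hc
        obtain ⟨V, t, ht⟩ := mod_prime_step p s π hπ U W
          ⟨C r * b, by rw [← hb, C_mul]; ring⟩ hnd
        have h2 : (C f : MvPolynomial (Fin 2) R) = C π * D t := by
          rw [← hCD, ← ht, map_sub, hs, hpoly', sub_zero]
        have h3 : π ∣ f := by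
          have : C π ∣ (C f : MvPolynomial (Fin 2) R) := ⟨_, h2⟩
          rw [C_dvd_iff_dvd_coeff] at this
          simpa using this 0
        obtain ⟨f', hf'⟩ := h3
        have h4 : D t = C f' := by
          apply mul_left_cancel₀ hCπ
          rw [← h2, hf', C_mul]
        have h5 := (hJ f').mp ⟨t, h4⟩
        obtain ⟨g, hg⟩ := h5
        apply hπ.not_unit
        apply IsUnit.of_mul_eq_one g
        apply mul_left_cancel₀ hf0
        calc f * (π * g) = π * (f * g) := by ring
          _ = f * 1 := by rw [← hg, ← hf', mul_one]
      obtain ⟨u', rfl⟩ := h1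
      have h2 : C π ∣ c := ⟨C r * b - u' * s, by
        rw [C_mul] at hb
        linear_combination -hb⟩
      obtain ⟨c', rfl⟩ := h2
      rw [hCD] at hu hc
      rw [C_mul]
      apply mul_dvd_mul_left
      refine ih hr b u' c' ((mul_eq_zero.mp hu).resolve_left hCπ)
        ((mul_eq_zero.mp hc).resolve_left hCπ) ?_
      apply mul_left_cancel₀ hCπ
      rw [C_mul] at hb
      linear_combination hb
  have hCf : (C f : MvPolynomial (Fin 2) R) ≠ 0 := by simpa using hf0
  refine ⟨p, f, hf0, hp, fun a => ⟨?_, ?_⟩⟩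
  · rintro ⟨ha, b, hb⟩
    obtain ⟨w, hw⟩ := key f hf0 b a (C f * b - a * s) ha (by
      rw [map_sub, hCD, Derivation.leibniz, hs, ha, hb]
      simp [mul_comm]) (by ring)
    refine ⟨w, ?_, hw⟩
    rw [← hp]
    rw [hw, hCD] at ha
    exact (mul_eq_zero.mp ha).resolve_left hCf
  · rintro ⟨r, hr, rfl⟩
    rw [← hp] at hr
    refine ⟨by rw [hCD, hr, mul_zero], s * r, ?_⟩
    rw [Derivation.leibniz, hr, hs]
    simp [mul_comm]

def eqv (k : Type) [Field k] : MvPolynomial (Fin 3) k ≃ₐ[k] MvPolynomial (Fin 2) (Polynomial k) :=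
  (MvPolynomial.renameEquiv k (finSuccEquiv 2)).trans (MvPolynomial.optionEquivRight k (Fin 2))

theorem eqv_X (k : Type) [Field k] : eqv k (X 0) = C Polynomial.X := by
  simp [eqv, optionEquivRight_X_none]

theorem eqv_aeval (k : Type) [Field k] (q : Polynomial k) :
    eqv k (Polynomial.aeval (X 0) q) = C q := by
  have h : eqv k (Polynomial.aeval (X 0) q) = Polynomial.aeval (eqv k (X 0)) q :=
    (Polynomial.aeval_algHom_apply (eqv k).toAlgHom (X 0) q).symm
  rw [h, eqv_X]
  have h2 := Polynomial.aeval_algHom_apply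
    (IsScalarTower.toAlgHom k (Polynomial k) (MvPolynomial (Fin 2) (Polynomial k))) Polynomial.X q
  rw [Polynomial.aeval_X_left_apply] at h2
  exact h2

def trDer {k : Type} [Field k]
    (D : Derivation k (MvPolynomial (Fin 3) k) (MvPolynomial (Fin 3) k)) (hx : D (X 0) = 0) :
    Derivation (Polynomial k) (MvPolynomial (Fin 2) (Polynomial k))
      (MvPolynomial (Fin 2) (Polynomial k)) :=
  Derivation.mk'
    { toFun := fun b => eqv k (D ((eqv k).symm b))
      map_add' := by intro a b; simp
      map_smul' := by
        intro q b
        rw [MvPolynomial.smul_eq_C_mul, ← eqv_aeval, map_mul, AlgEquiv.symm_apply_apply,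
          Derivation.leibniz, Derivation.map_aeval, hx]
        simp [MvPolynomial.smul_eq_C_mul, eqv_aeval] }
    (by intro a b; simp)

theorem trDer_apply {k : Type} [Field k]
    (D : Derivation k (MvPolynomial (Fin 3) k) (MvPolynomial (Fin 3) k)) (hx : D (X 0) = 0)
    (b : MvPolynomial (Fin 3) k) : trDer D hx (eqv k b) = eqv k (D b) := by
  change eqv k (D ((eqv k).symm (eqv k b))) = _
  rw [AlgEquiv.symm_apply_apply]

theorem mem_transfer {k : Type} [Field k] (p : MvPolynomial (Fin 2) (Polynomial k))
    (r : MvPolynomial (Fin 3) k) :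
    eqv k r ∈ Algebra.adjoin (Polynomial k) {p} ↔
      r ∈ Algebra.adjoin k ({X 0, (eqv k).symm p} : Set (MvPolynomial (Fin 3) k)) := by
  constructor
  · have key : ∀ b ∈ Algebra.adjoin (Polynomial k) {p}, (eqv k).symm b ∈
        Algebra.adjoin k ({X 0, (eqv k).symm p} : Set (MvPolynomial (Fin 3) k)) := by
      intro b hb
      induction hb using Algebra.adjoin_induction with
      | mem x hx =>
        rw [Set.mem_singleton_iff.mp hx]
        exact Algebra.subset_adjoin (by simp)
      | algebraMap q =>
        rw [MvPolynomial.algebraMap_eq, ← eqv_aeval, AlgEquiv.symm_apply_apply]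
        exact Algebra.adjoin_mono (by simp) (Polynomial.aeval_mem_adjoin_singleton k (X 0))
      | add x y _ _ hx hy => rw [map_add]; exact add_mem hx hy
      | mul x y _ _ hx hy => rw [map_mul]; exact mul_mem hx hy
    intro h
    simpa using key _ h
  · intro h
    induction h using Algebra.adjoin_induction with
    | mem x hx =>
      rcases hx with rfl | hx
      · rw [eqv_X]
        exact Subalgebra.algebraMap_mem (Algebra.adjoin (Polynomial k) {p}) Polynomial.X
      · rw [Set.mem_singleton_iff.mp hx, AlgEquiv.apply_symm_apply]
        exact Algebra.self_mem_adjoin_singleton _ p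
    | algebraMap c =>
      have : eqv k (algebraMap k _ c) = C (Polynomial.C c) := by
        rw [← eqv_aeval]; simp
      rw [this]
      exact Subalgebra.algebraMap_mem (Algebra.adjoin (Polynomial k) {p}) (Polynomial.C c)
    | add x y _ _ hx hy => rw [map_add]; exact add_mem hx hy
    | mul x y _ _ hx hy => rw [map_mul]; exact mul_mem hx hy

/-- Lemma 2.9 (rank-two): if `D` is a nonzero irreducible locally nilpotent derivation of
`B = k[x,y,z]` with `D x = 0`, then there are `p ∈ B` and a nonzero `f(x) ∈ k[x]` with
`ker D = k[x, p]` and plinth ideal `ker D ∩ D(B) = f(x)·k[x, p]`. -/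
theorem statement_7 (k : Type) [Field k] [CharZero k]
    (D : Derivation k (MvPolynomial (Fin 3) k) (MvPolynomial (Fin 3) k))
    (hlnd : IsLND D) (hirr : IsIrreducibleDeriv D) (hD0 : D ≠ 0)
    (hx : D (X 0) = 0) :
    ∃ (p : MvPolynomial (Fin 3) k) (q : Polynomial k), q ≠ 0 ∧
      (∀ r : MvPolynomial (Fin 3) k,
        D r = 0 ↔ r ∈ Algebra.adjoin k ({X 0, p} : Set (MvPolynomial (Fin 3) k))) ∧
      (∀ a : MvPolynomial (Fin 3) k,
        (D a = 0 ∧ ∃ b : MvPolynomial (Fin 3) k, D b = a) ↔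
          ∃ r ∈ Algebra.adjoin k ({X 0, p} : Set (MvPolynomial (Fin 3) k)),
            a = Polynomial.aeval (X 0 : MvPolynomial (Fin 3) k) q * r) := by
  let D' := trDer D hx
  have hD' : ∀ b, D' (eqv k b) = eqv k (D b) := trDer_apply D hx
  have hit : ∀ (n : ℕ) b, (⇑D')^[n] (eqv k b) = eqv k ((⇑D)^[n] b) := by
    intro n
    induction n with
    | zero => intro b; rfl
    | succ n ih => intro b; rw [Function.iterate_succ_apply, Function.iterate_succ_apply, hD', ih]
  have hl : IsLND D' := by
    intro b
    obtain ⟨b, rfl⟩ := (eqv k).surjective b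
    obtain ⟨n, hn⟩ := hlnd b
    exact ⟨n, by rw [hit, hn, map_zero]⟩
  have h0 : D' ≠ 0 := by
    intro h
    apply hD0
    refine Derivation.ext fun b => ?_
    apply (eqv k).injective
    rw [← hD', h]
    simp
  have hi : IsIrreducibleDeriv D' := by
    intro b hb
    obtain ⟨b, rfl⟩ := (eqv k).surjective b
    apply IsUnit.map
    apply hirr
    intro r
    have h1 := hb (eqv k r)
    rw [Ideal.mem_span_singleton, hD'] at h1
    rw [Ideal.mem_span_singleton]
    exact (map_dvd_iff (eqv k)).mp h1
  obtain ⟨p, f, hf0, hker, hpl⟩ := main_R D' hl h0 hi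
  have hz : ∀ b, D b = 0 ↔ D' (eqv k b) = 0 := by
    intro b
    rw [hD']
    exact (map_eq_zero_iff (eqv k) (eqv k).injective).symm
  refine ⟨(eqv k).symm p, f, hf0, ?_, ?_⟩
  · intro r
    rw [hz, hker, mem_transfer]
  · intro a
    constructor
    · rintro ⟨ha, b, hb⟩
      obtain ⟨r, hr, har⟩ := (hpl (eqv k a)).mp ⟨(hz a).mp ha, eqv k b, by rw [hD', hb]⟩
      obtain ⟨r, rfl⟩ := (eqv k).surjective r
      refine ⟨r, (mem_transfer p r).mp hr, ?_⟩
      apply (eqv k).injective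
      rw [har, map_mul, eqv_aeval]
    · rintro ⟨r, hr, har⟩
      obtain ⟨h1, b, h2⟩ := (hpl (eqv k a)).mpr ⟨eqv k r, (mem_transfer p r).mpr hr, by
        rw [har, map_mul, eqv_aeval]⟩
      obtain ⟨b, rfl⟩ := (eqv k).surjective b
      refine ⟨(hz a).mpr h1, b, ?_⟩
      apply (eqv k).injective
      rw [← hD', h2]
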